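/- Let m ≥ 5 be odd, let u be a positive integer with gcd(u, m) = 1, and suppose either (m² − 1)/8 is even and ρ = 0, or (m² − 1)/8 is odd and ρ = 1. Set n = 2^{m−2} − 2^{(m−3)/2}. Then the codewords of weight w1 = 2^{m−3} − 2^{(m−3)/2} in C_{D_ρ} hold a 2-(n, w1, w1 − 1) design, and the codewords of weight w2 = 2^{m−3} in C_{D_ρ} hold a 2-(n, w2, λ) design where λ satisfies λ·n·(n − 1) = (2^{m−1} − 1)·2^{m−3}·(2^{m−3} − 1). -/

import Mathlib

/-- Hamming weight of a binary vector: the number of nonzero coordinates. -/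
noncomputable def wt {ι : Type*} (c : ι → ZMod 2) : ℕ := Nat.card {i : ι // c i ≠ 0}

/-- Number of codewords of Hamming weight `w` in a set of binary vectors. -/
noncomputable def weightCount {ι : Type*} (C : Set (ι → ZMod 2)) (w : ℕ) : ℕ :=
  Nat.card {c : ι → ZMod 2 // c ∈ C ∧ wt c = w}

/-- The dual code: all vectors orthogonal (standard inner product) to every codeword. -/
def dualCode {ι : Type*} (C : Set (ι → ZMod 2)) : Set (ι → ZMod 2) :=
  {x | ∀ c ∈ C, ∑ᶠ i, x i * c i = 0}

/-- A code is projective if the minimum distance of its dual is at least 3. -/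
def IsProjective {ι : Type*} (C : Set (ι → ZMod 2)) : Prop :=
  ∀ x ∈ dualCode C, x ≠ 0 → 3 ≤ wt x

/-- `d` is the minimum distance of `C`: the least Hamming weight of a nonzero codeword. -/
def IsMinDist {ι : Type*} (C : Set (ι → ZMod 2)) (d : ℕ) : Prop :=
  (∃ c ∈ C, c ≠ 0 ∧ wt c = d) ∧ ∀ c ∈ C, c ≠ 0 → d ≤ wt c

/-- The number of nonzero Hamming weights occurring among codewords of `C`. -/
noncomputable def numNonzeroWeights {ι : Type*} (C : Set (ι → ZMod 2)) : ℕ :=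
  Nat.card {i : ℕ | 1 ≤ i ∧ weightCount C i ≠ 0}

/-- The codewords of weight `w` in `C` hold a 2-design with index `lam`: every pair of
distinct coordinate positions lies in the support of exactly `lam` codewords of weight `w`. -/
def HoldsTwoDesign {ι : Type*} (C : Set (ι → ZMod 2)) (w lam : ℕ) : Prop :=
  ∀ p q : ι, p ≠ q →
    Nat.card {c : ι → ZMod 2 // c ∈ C ∧ wt c = w ∧ c p ≠ 0 ∧ c q ≠ 0} = lam

/-- The defining set `D_ρ = {x ∈ F_{2^m} : Tr(x) = 1, Tr(x^{2^u+1}) = ρ}`. -/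
def Dset (m u : ℕ) (ρ : ZMod 2) : Set (GaloisField 2 m) :=
  {x | Algebra.trace (ZMod 2) (GaloisField 2 m) x = 1 ∧
       Algebra.trace (ZMod 2) (GaloisField 2 m) (x ^ (2 ^ u + 1)) = ρ}

/-- The linear map `b ↦ (Tr(b·d))_{d ∈ D_ρ}`. -/
noncomputable def codeMap (m u : ℕ) (ρ : ZMod 2) :
    GaloisField 2 m →ₗ[ZMod 2] (↥(Dset m u ρ) → ZMod 2) :=
  LinearMap.pi fun d =>
    (Algebra.trace (ZMod 2) (GaloisField 2 m)).comp
      (LinearMap.mulRight (ZMod 2) (d : GaloisField 2 m))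

/-- The code `C_{D_ρ} = {(Tr(b·d))_{d ∈ D_ρ} : b ∈ F_{2^m}}`. -/
noncomputable def codeD (m u : ℕ) (ρ : ZMod 2) :
    Submodule (ZMod 2) (↥(Dset m u ρ) → ZMod 2) :=
  LinearMap.range (codeMap m u ρ)

open Finset

/-- The nontrivial additive character of `ZMod 2`. -/
def chi (a : ZMod 2) : ℤ := if a = 0 then 1 else -1

lemma chi_add (a b : ZMod 2) : chi (a + b) = chi a * chi b := by
  revert a b; decide

lemma chi_zero : chi 0 = 1 := by decide
lemma chi_one : chi 1 = -1 := by decide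

lemma zmod2_cases (a : ZMod 2) : a = 0 ∨ a = 1 := by revert a; decide

lemma zmod2_ne_zero (a : ZMod 2) : a ≠ 0 ↔ a = 1 := by revert a; decide

lemma zmod2_add_self (a : ZMod 2) : a + a = 0 := by revert a; decide

lemma ind_chi (a b : ZMod 2) : (if a = b then (2 : ℤ) else 0) = 1 + chi b * chi a := by
  revert a b; decide

lemma ind3 (a b c a' b' c' : ZMod 2) : (8 : ℤ) * (if a = a' ∧ b = b' ∧ c = c' then 1 else 0)
    = (1 + chi a' * chi a) * (1 + chi b' * chi b) * (1 + chi c' * chi c) := by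
  rw [← ind_chi, ← ind_chi, ← ind_chi]
  by_cases h1 : a = a' <;> by_cases h2 : b = b' <;> by_cases h3 : c = c' <;> simp [h1, h2, h3]

lemma count3 {V : Type*} [Fintype V] (f g h : V → ZMod 2) (a b c : ZMod 2) :
    8 * ((univ.filter fun x => f x = a ∧ g x = b ∧ h x = c).card : ℤ)
    = Fintype.card V + chi a * ∑ x, chi (f x) + chi b * ∑ x, chi (g x) + chi c * ∑ x, chi (h x)
      + chi a * chi b * ∑ x, chi (f x + g x) + chi a * chi c * ∑ x, chi (f x + h x)
      + chi b * chi c * ∑ x, chi (g x + h x)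
      + chi a * chi b * chi c * ∑ x, chi (f x + g x + h x) := by
  rw [Finset.card_filter]
  push_cast
  rw [Finset.mul_sum]
  have hc : (Fintype.card V : ℤ) = ∑ x : V, (1 : ℤ) := by simp
  rw [hc]
  simp only [Finset.mul_sum, ← Finset.sum_add_distrib]
  refine Finset.sum_congr rfl fun x _ => ?_
  rw [ind3, chi_add, chi_add, chi_add, chi_add, chi_add]
  ring

lemma sum_shift_zero {V : Type*} [Fintype V] [AddCommGroup V] (f : V → ℤ) (a : V)
    (h : ∀ x, f (x + a) = - f x) : ∑ x, f x = 0 := by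
  have h1 : ∑ x, f (x + a) = ∑ x, f x := Equiv.sum_comp (Equiv.addRight a) f
  simp only [h, Finset.sum_neg_distrib] at h1
  linarith

/-- The data of a quadratic form `Q` with polarization `B`, a linear form `T` and a vector `e`
spanning the radical. -/
structure QData (V : Type*) [AddCommGroup V] where
  T : V → ZMod 2
  Q : V → ZMod 2
  B : V → V → ZMod 2
  e : V
  hT : ∀ x y, T (x + y) = T x + T y
  hQ : ∀ x y, Q (x + y) = Q x + Q y + B x y
  hB : ∀ x y z, B (x + y) z = B x z + B y z
  hs : ∀ x y, B x y = B y x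
  Te : T e = 1
  Qe : Q e = 1
  Be : ∀ x, B e x = 0
  rad : ∀ x, x ≠ 0 → x ≠ e → ∃ y, B x y = 1

namespace QData
set_option linter.unusedSectionVars false
variable {V : Type*} [AddCommGroup V] [Fintype V] (D : QData V)

/-- The basic exponential sum. -/
def S : ℤ := ∑ x, chi (D.Q x + D.T x)

lemma hB' (x y z : V) : D.B x (y + z) = D.B x y + D.B x z := by
  rw [D.hs, D.hB, D.hs y, D.hs z]

lemma Be' (x : V) : D.B x D.e = 0 := by rw [D.hs, D.Be]

lemma sumT : ∑ x, chi (D.T x) = 0 := by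
  apply sum_shift_zero _ D.e
  intro x; rw [D.hT, D.Te, chi_add, chi_one]; ring

lemma sumQ : ∑ x, chi (D.Q x) = 0 := by
  apply sum_shift_zero _ D.e
  intro x; rw [D.hQ, D.Qe, D.Be', chi_add, chi_add, chi_one, chi_zero]; ring

lemma sumTB (y : V) : ∑ x, chi (D.T x + D.B y x) = 0 := by
  apply sum_shift_zero _ D.e
  intro x; simp only [D.hT, D.Te, D.hB', D.Be', chi_add, chi_one, chi_zero]; ring

lemma sumQB (y : V) : ∑ x, chi (D.Q x + D.B y x) = 0 := by
  apply sum_shift_zero _ D.e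
  intro x; simp only [D.hQ, D.Qe, D.hB', D.Be', chi_add, chi_one, chi_zero]; ring

lemma sumB (y : V) (h0 : y ≠ 0) (he : y ≠ D.e) : ∑ x, chi (D.B y x) = 0 := by
  obtain ⟨z, hz⟩ := D.rad y h0 he
  apply sum_shift_zero _ z
  intro x; simp only [hz, D.hB', chi_add, chi_one]; ring

lemma chi_sq (a : ZMod 2) : chi a * chi a = 1 := by revert a; decide

lemma sumQTB (y : V) : ∑ x, chi (D.Q x + D.T x + D.B y x) = chi (D.Q y + D.T y) * D.S := by
  have h1 : ∑ x, chi (D.Q (x + y) + D.T (x + y)) = D.S :=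
    Equiv.sum_comp (Equiv.addRight y) fun x => chi (D.Q x + D.T x)
  rw [← h1, Finset.mul_sum]
  refine Finset.sum_congr rfl fun x _ => ?_
  rw [D.hQ, D.hT, D.hs y x]
  simp only [chi_add]
  linear_combination (-chi (D.Q x) * chi (D.T x) * chi (D.B x y)) * chi (D.T y) * chi (D.T y) *
    chi_sq (D.Q y) - (chi (D.Q x) * chi (D.T x) * chi (D.B x y)) * chi_sq (D.T y)

lemma count_weight (ρ ε : ZMod 2) (y : V) (h0 : y ≠ 0) (he : y ≠ D.e) :
    8 * ((univ.filter fun x => D.T x = 1 ∧ D.Q x = ρ ∧ D.B y x = ε).card : ℤ)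
    = Fintype.card V - chi ρ * D.S - chi ρ * chi ε * chi (D.Q y + D.T y) * D.S := by
  rw [count3, D.sumT, D.sumQ, D.sumTB, D.sumQB, D.sumB y h0 he]
  have h1 : ∑ x, chi (D.T x + D.Q x) = D.S := by simp only [S, add_comm]
  have h2 := D.sumQTB y
  simp only [add_comm (D.Q _) (D.T _)] at h2
  rw [h1, h2, chi_one, add_comm (D.T y)]
  ring

lemma count_n (ρ : ZMod 2) :
    4 * ((univ.filter fun x => D.T x = 1 ∧ D.Q x = ρ).card : ℤ)
    = Fintype.card V - chi ρ * D.S := by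
  have h := count3 D.T D.Q (fun _ => 0) 1 ρ 0
  have h1 : ∑ x, chi (D.T x + D.Q x) = D.S := by simp only [S, add_comm]
  simp only [add_zero, and_true, D.sumT, D.sumQ, h1, chi_one, chi_zero] at h
  simp at h
  linarith

lemma count_design (ρ η : ZMod 2) (p q : V) (hp : D.T p = 1) (hp' : D.Q p = ρ)
    (hq : D.T q = 1) (hq' : D.Q q = ρ) (h0 : p + q ≠ 0) :
    8 * ((univ.filter fun x => D.Q x = η ∧ D.T x + D.B p x = 1 ∧ D.T x + D.B q x = 1).card : ℤ)
    = Fintype.card V + 2 * chi η * chi ρ * D.S := by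
  have he : p + q ≠ D.e := by
    intro h
    have := D.hT p q
    rw [h, D.Te, hp, hq] at this
    revert this; decide
  rw [count3, D.sumQ, D.sumTB, D.sumTB]
  have e1 : ∀ x, D.T x + D.B p x + (D.T x + D.B q x) = D.B (p + q) x := by
    intro x
    rw [D.hB]
    linear_combination zmod2_add_self (D.T x)
  have e2 : ∀ x, D.Q x + (D.T x + D.B p x) + (D.T x + D.B q x) = D.Q x + D.B (p + q) x := by
    intro x
    rw [← e1]; ring
  simp only [e1, e2]
  rw [D.sumB _ h0 he, D.sumQB]
  simp only [← add_assoc]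
  rw [D.sumQTB, D.sumQTB, hp, hp', hq, hq', chi_add, chi_one]
  ring

end QData

section transfer

lemma path_sum (M : Matrix (ZMod 2) (ZMod 2) ℤ) (n : ℕ) (F : ZMod 2 → ZMod 2 → ℤ) :
    ∑ v : Fin (n + 1) → ZMod 2, F (v 0) (v (Fin.last n)) *
      ∏ i : Fin n, M (v i.castSucc) (v i.succ) = ∑ a, ∑ b, F a b * (M ^ n) a b := by
  induction n generalizing F with
  | zero =>
    rw [← (Equiv.funUnique (Fin 1) (ZMod 2)).symm.sum_comp]
    simp [Matrix.one_apply]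
  | succ n ih =>
    rw [← (Fin.snocEquiv (fun _ : Fin (n + 2) => ZMod 2)).sum_comp, Fintype.sum_prod_type,
      Finset.sum_comm]
    have := ih (fun a c => ∑ b, F a b * M c b)
    rw [pow_succ]
    simp only [Matrix.mul_apply]
    have e : ∀ a : ZMod 2, ∑ b, (∑ c, F a c * M b c) * (M ^ n) a b
      = ∑ b, F a b * ∑ j, (M ^ n) a j * M j b := by
      intro a
      simp only [Finset.mul_sum, Finset.sum_mul]
      rw [Finset.sum_comm]
      refine Finset.sum_congr rfl fun b _ => Finset.sum_congr rfl fun c _ => by ring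
    simp only [e] at this
    rw [← this]
    refine Finset.sum_congr rfl fun v _ => ?_
    rw [Finset.sum_mul]
    refine Finset.sum_congr rfl fun b _ => ?_
    rw [Fin.prod_univ_castSucc]
    have h0 : (Fin.snoc (α := fun _ : Fin (n + 2) => ZMod 2) v b) 0 = v 0 := by
      rw [← Fin.castSucc_zero]
      exact Fin.snoc_castSucc (α := fun _ : Fin (n + 2) => ZMod 2) _ _ _
    simp only [Fin.snocEquiv_apply, Fin.snoc_last, h0, Fin.snoc_castSucc, Fin.succ_last, Fin.succ_castSucc]
    ring

/-- transfer matrix -/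
def MM : Matrix (ZMod 2) (ZMod 2) ℤ := fun a b => chi (a * b + a)

lemma MM4 : MM ^ 4 = (-4 : ℤ) • (1 : Matrix (ZMod 2) (ZMod 2) ℤ) := by decide

lemma cyc_sum (n : ℕ) :
    ∑ v : Fin (n + 1) → ZMod 2, chi (∑ i, v i * v (i + 1) + ∑ i, v i) = (MM ^ (n + 1)).trace := by
  have := path_sum MM n (fun a b => MM b a)
  rw [pow_succ', Matrix.trace]
  simp only [Matrix.diag, Matrix.mul_apply]
  rw [Finset.sum_comm, ← this]
  refine Finset.sum_congr rfl fun v _ => ?_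
  have hs : ∀ (f : Fin (n + 1) → ZMod 2), chi (∑ i, f i) = ∏ i, chi (f i) := by
    intro f
    induction (univ : Finset (Fin (n + 1))) using Finset.induction_on with
    | empty => simp [chi_zero]
    | insert a s ha ih => rw [Finset.sum_insert ha, Finset.prod_insert ha, chi_add, ih]
  rw [← Finset.sum_add_distrib, hs, Fin.prod_univ_castSucc, mul_comm]
  simp [MM]

lemma trMM (m : ℕ) (hm : Odd m) (ρ : ZMod 2)
    (hρ : (Even ((m ^ 2 - 1) / 8) ∧ ρ = 0) ∨ (Odd ((m ^ 2 - 1) / 8) ∧ ρ = 1)) :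
    (MM ^ m).trace = chi ρ * 2 ^ ((m + 1) / 2) := by
  have h8 : MM ^ 8 = (16 : ℤ) • (1 : Matrix (ZMod 2) (ZMod 2) ℤ) := by decide
  have key : ∀ j r : ℕ, (MM ^ (8 * j + r)).trace = 16 ^ j * (MM ^ r).trace := by
    intro j r
    rw [pow_add, pow_mul, h8, smul_pow, one_pow, Matrix.smul_mul, one_mul, Matrix.trace_smul]
    simp
  obtain ⟨j, r, hr, rfl⟩ : ∃ j r, r < 8 ∧ m = 8 * j + r := ⟨m / 8, m % 8, Nat.mod_lt _ (by norm_num), by omega⟩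
  rw [key]
  have hodd : r % 2 = 1 := by
    have := Nat.odd_iff.mp hm; omega
  have hsq : ((8 * j + r) ^ 2 - 1) / 8 = 8 * j ^ 2 + 2 * j * r + (r ^ 2 - 1) / 8 := by
    have : (8 * j + r) ^ 2 - 1 = 8 * (8 * j ^ 2 + 2 * j * r) + (r ^ 2 - 1) := by
      have : 1 ≤ r ^ 2 := Nat.one_le_pow _ _ (by omega)
      have e : (8 * j + r) ^ 2 = 8 * (8 * j ^ 2 + 2 * j * r) + r ^ 2 := by ring
      omega
    rw [this]; omega
  have hpar : ((8 * j + r) ^ 2 - 1) / 8 % 2 = (r ^ 2 - 1) / 8 % 2 := by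
    rw [hsq, mul_assoc]; omega
  rw [Nat.even_iff, Nat.odd_iff, hpar] at hρ
  have h16 : (16 : ℤ) ^ j = 2 ^ (4 * j) := by rw [pow_mul]; norm_num
  have hexp : (8 * j + r + 1) / 2 = 4 * j + (r + 1) / 2 := by omega
  rw [h16, hexp, pow_add, mul_comm (chi ρ), mul_assoc]
  congr 1
  have t1 : (MM ^ 1).trace = 2 := by decide
  have t3 : (MM ^ 3).trace = -4 := by decide
  have t5 : (MM ^ 5).trace = -8 := by decide
  have t7 : (MM ^ 7).trace = 16 := by decide
  interval_cases r <;> simp_all [chi_one, chi_zero]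

end transfer

section selfdual

set_option linter.unusedSectionVars false

variable {F : Type*} [Field F] [Finite F] [Algebra (ZMod 2) F]

local notation "Tr" => Algebra.trace (ZMod 2) F

lemma sum_symm_diag {G : Type*} [Fintype G] [DecidableEq G] (f : G → G → ZMod 2)
    (hf : ∀ g h, f g h = f h g) : ∑ g, ∑ h, f g h = ∑ g, f g g := by
  rw [← Finset.sum_product', ← Finset.diag_union_offDiag univ, Finset.sum_union
    (Finset.disjoint_diag_offDiag _), Finset.sum_diag]
  simp only [add_eq_left]
  refine Finset.sum_involution (fun p _ => p.swap) ?_ ?_ ?_ ?_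
  · intro p _
    simp only [Prod.fst_swap, Prod.snd_swap]
    rw [hf p.2 p.1]; exact zmod2_add_self _
  · intro p hp _ h
    simp only [Finset.mem_offDiag] at hp
    apply hp.2.2
    have := congrArg Prod.fst h
    simpa using this.symm
  · intro p hp
    simp only [Finset.mem_offDiag] at hp ⊢
    exact ⟨hp.2.1, hp.1, fun h => hp.2.2 h.symm⟩
  · intro p _; simp

lemma tr_inv (g : Gal(F/ZMod 2)) (x y : F) : Tr (g x * g y) = Tr (x * y) := by
  rw [← map_mul]
  exact Algebra.trace_eq_of_algEquiv g (x * y)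

lemma tr_inv' (g : Gal(F/ZMod 2)) (x : F) : Tr (g x) = Tr x :=
  Algebra.trace_eq_of_algEquiv g x

lemma exists_selfdual [Fintype Gal(F/ZMod 2)] [DecidableEq Gal(F/ZMod 2)]
    (hcomm : ∀ a b : Gal(F/ZMod 2), a * b = b * a)
    (hodd : Odd (Nat.card Gal(F/ZMod 2))) :
    ∃ θ : F, ∀ g h : Gal(F/ZMod 2), Tr (g θ * h θ) = if g = h then 1 else 0 := by
  classical
  have : FiniteDimensional (ZMod 2) F := Module.Finite.of_finite
  let bas := IsGalois.normalBasis (ZMod 2) F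
  set φ : F := bas 1 with hφ
  have hbas : ∀ g, bas g = g φ := fun g => IsGalois.normalBasis_apply g
  set ψ : F := bas.traceDual 1 with hψ
  have hψφ : ∀ g : Gal(F/ZMod 2), Tr (ψ * g φ) = if g = 1 then 1 else 0 := by
    intro g
    rw [← hbas]
    exact bas.trace_traceDual_mul 1 g
  set a : Gal(F/ZMod 2) → ZMod 2 := fun g => bas.repr ψ g with ha
  have hψa : ψ = ∑ g, a g • g φ := by
    conv_lhs => rw [← bas.sum_repr ψ]
    simp only [hbas, ha]
  have ha1 : ∀ g : Gal(F/ZMod 2), Tr (ψ * g ψ) = a g := by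
    intro g
    have h1 : ∀ h : Gal(F/ZMod 2), Tr (h φ * g ψ) = if h = g then 1 else 0 := by
      intro h
      have : h φ = g ((g⁻¹ * h) φ) := by
        rw [← AlgEquiv.mul_apply, mul_inv_cancel_left]
      rw [this, tr_inv, mul_comm, hψφ]
      simp only [inv_mul_eq_one, eq_comm]
    conv_lhs => rw [hψa]
    rw [Finset.sum_mul, map_sum]
    rw [← hψa]
    simp [h1]
  have hsym : ∀ g, a g⁻¹ = a g := by
    intro g
    rw [← ha1, ← ha1, ← tr_inv g, mul_comm, ← AlgEquiv.mul_apply, mul_inv_cancel]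
    simp
  set b : Gal(F/ZMod 2) → ZMod 2 := fun g => a (g ^ 2) with hb
  have hbsym : ∀ g, b g⁻¹ = b g := by
    intro g; simp only [hb, inv_pow, hsym]
  refine ⟨∑ g, b g • g φ, ?_⟩
  set θ := ∑ g, b g • g φ with hθ
  have main : ∀ k : Gal(F/ZMod 2), Tr (θ * k θ) = if k = 1 then 1 else 0 := by
    intro k
    have e1 : Tr (θ * k θ) = ∑ g, ∑ h, b g * b h * Tr (g φ * k (h φ)) := by
      rw [hθ, map_sum, Finset.sum_mul_sum, map_sum]
      refine Finset.sum_congr rfl fun g _ => ?_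
      rw [map_sum]
      refine Finset.sum_congr rfl fun h _ => ?_
      rw [map_smul, smul_mul_smul_comm, map_smul, smul_eq_mul]
    have e2 : Tr (θ * k θ) = ∑ g, ∑ h, b g * b h * Tr ((g * h) φ * k φ) := by
      rw [e1]
      refine Finset.sum_congr rfl fun g _ => ?_
      rw [← Equiv.sum_comp (Equiv.inv _)]
      refine Finset.sum_congr rfl fun h _ => ?_
      simp only [Equiv.inv_apply, hbsym]
      congr 1
      rw [← tr_inv h]
      simp only [← AlgEquiv.mul_apply]
      rw [hcomm h g, hcomm k, ← mul_assoc, mul_inv_cancel, one_mul]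
    rw [e2, sum_symm_diag _ (by intro g h; rw [hcomm g h, mul_comm (b g)])]
    have hbij : Function.Bijective (fun g : Gal(F/ZMod 2) => g ^ 2) :=
      (powCoprime (G := Gal(F/ZMod 2)) (n := 2) (Nat.coprime_two_right.mpr hodd)).bijective
    have e3 : ∑ g, b g * b g * Tr ((g * g) φ * k φ) = ∑ g, a g * Tr (g φ * k φ) := by
      rw [← hbij.sum_comp (fun g => a g * Tr (g φ * k φ))]
      refine Finset.sum_congr rfl fun g _ => ?_
      have : ∀ z : ZMod 2, z * z = z := by decide
      rw [this, sq]
      simp only [hb, sq]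
    rw [e3, ← hψφ]
    conv_rhs => rw [hψa]
    rw [Finset.sum_mul, map_sum]
    simp
  intro g h
  have : h θ = g ((g⁻¹ * h) θ) := by
    rw [← AlgEquiv.mul_apply, mul_inv_cancel_left]
  rw [this, tr_inv, main]
  simp only [inv_mul_eq_one]

lemma S_eval [Fintype F] (n : ℕ) (hn : Module.finrank (ZMod 2) F = n + 1) (hodd : Odd (n + 1))
    (τ : Gal(F/ZMod 2)) (hτ : ∀ g, g ∈ Subgroup.zpowers τ) :
    ∑ x : F, chi (Tr (x * τ x) + Tr x) = (MM ^ (n + 1)).trace := by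
  classical
  have : FiniteDimensional (ZMod 2) F := Module.Finite.of_finite
  have : Fintype Gal(F/ZMod 2) := Fintype.ofFinite _
  have hcard : Nat.card Gal(F/ZMod 2) = n + 1 := by
    rw [IsGalois.card_aut_eq_finrank, hn]
  have hord : orderOf τ = n + 1 := by
    rw [← hcard]; exact orderOf_eq_card_of_forall_mem_zpowers hτ
  have hcomm : ∀ a b : Gal(F/ZMod 2), a * b = b * a := by
    intro a b
    obtain ⟨i, rfl⟩ := hτ a
    obtain ⟨j, rfl⟩ := hτ b
    exact (Commute.zpow_zpow_self τ i j)
  obtain ⟨θ, hθ⟩ := exists_selfdual (F := F) hcomm (by rw [hcard]; exact hodd)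
  -- the coordinates
  let X : (Fin (n + 1) → ZMod 2) → F := fun v => ∑ i, v i • (τ ^ (i : ℕ)) θ
  have hortho : ∀ i j : Fin (n + 1), Tr ((τ ^ (i : ℕ)) θ * (τ ^ (j : ℕ)) θ)
      = if i = j then 1 else 0 := by
    intro i j
    rw [hθ]
    have : τ ^ (i : ℕ) = τ ^ (j : ℕ) ↔ i = j := by
      rw [pow_inj_mod, hord, Nat.mod_eq_of_lt i.2, Nat.mod_eq_of_lt j.2, Fin.ext_iff]
    simp only [this]
  have hprod : ∀ v w, Tr (X v * X w) = ∑ i, v i * w i := by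
    intro v w
    simp only [X]
    rw [Finset.sum_mul_sum, map_sum]
    refine Finset.sum_congr rfl fun i _ => ?_
    rw [map_sum]
    simp only [smul_mul_smul_comm, map_smul, hortho]
    simp
  have hτX : ∀ v, τ (X v) = X (fun i => v (i - 1)) := by
    intro v
    simp only [X, map_sum, map_smul]
    rw [← Equiv.sum_comp (Equiv.addRight (1 : Fin (n + 1))) (fun i => v (i - 1) • (τ ^ (i : ℕ)) θ)]
    refine Finset.sum_congr rfl fun i _ => ?_
    simp only [Equiv.coe_addRight, add_sub_cancel_right]
    congr 1
    rw [← AlgEquiv.mul_apply, ← pow_succ']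
    congr 1
    rw [pow_inj_mod, hord, Fin.val_add]
    simp [Nat.add_mod]
  have hsq : ∀ x : F, Tr (x * x) = Tr x := by
    intro x
    have := tr_inv' (FiniteField.frobeniusAlgEquivOfAlgebraic (ZMod 2) F) x
    rw [← this]
    simp [sq]
  have hinj : Function.Injective X := by
    intro v w h
    funext i
    have h1 := hprod v (Pi.single i 1)
    rw [h, hprod] at h1
    simpa [Pi.single_apply] using h1.symm
  have hbij : Function.Bijective X := by
    rw [Fintype.bijective_iff_injective_and_card]
    refine ⟨hinj, ?_⟩
    rw [Module.card_eq_pow_finrank (K := ZMod 2) (V := F), hn]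
    simp
  rw [← hbij.sum_comp, ← cyc_sum]
  refine Finset.sum_congr rfl fun v _ => ?_
  congr 1
  rw [← hsq (X v), hτX, hprod, hprod]
  congr 1
  · rw [← Equiv.sum_comp (Equiv.addRight (1 : Fin (n + 1)))]
    refine Finset.sum_congr rfl fun i _ => ?_
    simp [mul_comm]
  · refine Finset.sum_congr rfl fun i _ => ?_
    have : ∀ z : ZMod 2, z * z = z := by decide
    exact this _

end selfdual

section field

set_option linter.unusedSectionVars false

variable {F : Type*} [Field F] [Finite F] [Algebra (ZMod 2) F]

local notation "Tr" => Algebra.trace (ZMod 2) F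

lemma field_add_self (x : F) : x + x = 0 := by
  have h := add_smul (1 : ZMod 2) 1 x
  rw [zmod2_add_self, zero_smul, one_smul] at h
  exact h.symm

/-- The linear map representing the polarization of `Tr (x * τ x)`. -/
def LL (τ : Gal(F/ZMod 2)) (x : F) : F := τ x + τ⁻¹ x

lemma tr_LL (τ : Gal(F/ZMod 2)) (x y : F) :
    Tr (LL τ x * y) = Tr (x * τ y) + Tr (y * τ x) := by
  rw [LL, add_mul, map_add, add_comm, mul_comm y]
  congr 1
  rw [← Algebra.trace_eq_of_algEquiv τ (τ⁻¹ x * y), map_mul, ← AlgEquiv.mul_apply,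
    mul_inv_cancel, AlgEquiv.one_apply]

lemma fixed_of_LL (τ : Gal(F/ZMod 2)) (hτ : ∀ g, g ∈ Subgroup.zpowers τ)
    (hodd : Odd (Module.finrank (ZMod 2) F)) (x : F) (hx : LL τ x = 0) : x = 0 ∨ x = 1 := by
  have : FiniteDimensional (ZMod 2) F := Module.Finite.of_finite
  have h1 : τ x = τ⁻¹ x := by
    have := field_add_self (τ⁻¹ x)
    rw [LL] at hx
    linear_combination hx - this
  have h2 : (τ ^ 2) x = x := by
    rw [sq, AlgEquiv.mul_apply, h1, ← AlgEquiv.mul_apply, mul_inv_cancel, AlgEquiv.one_apply]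
  have h2' : ∀ k : ℕ, ((τ ^ 2) ^ k) x = x := by
    intro k
    induction k with
    | zero => simp
    | succ k ih => rw [pow_succ, AlgEquiv.mul_apply, h2, ih]
  have hord : orderOf τ = Module.finrank (ZMod 2) F := by
    rw [← IsGalois.card_aut_eq_finrank]; exact orderOf_eq_card_of_forall_mem_zpowers hτ
  have h3 : τ x = x := by
    obtain ⟨k, hk⟩ := hodd
    have h4 := h2' (k + 1)
    rw [← pow_mul, show 2 * (k + 1) = (2 * k + 1) + 1 by ring, pow_succ, ← hk, ← hord,
      pow_orderOf_eq_one, one_mul] at h4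
    exact h4
  have h5 : ∀ g : Gal(F/ZMod 2), g x = x := by
    have hst : τ ∈ MulAction.stabilizer Gal(F/ZMod 2) x := by
      rw [MulAction.mem_stabilizer_iff]; exact h3
    intro g
    have hg : g ∈ MulAction.stabilizer Gal(F/ZMod 2) x :=
      (Subgroup.zpowers_le.mpr hst) (hτ g)
    rw [MulAction.mem_stabilizer_iff] at hg
    exact hg
  obtain ⟨c, hc⟩ := (IsGalois.mem_range_algebraMap_iff_fixed (F := ZMod 2) x).mpr h5
  rcases zmod2_cases c with rfl | rfl
  · left; rw [← hc, map_zero]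
  · right; rw [← hc, map_one]

/-- The quadratic data attached to `Tr (x * τ x)`. -/
noncomputable def fieldData (τ : Gal(F/ZMod 2)) (hτ : ∀ g, g ∈ Subgroup.zpowers τ)
    (hodd : Odd (Module.finrank (ZMod 2) F)) : QData F where
  T x := Tr x
  Q x := Tr (x * τ x)
  B x y := Tr (x * τ y) + Tr (y * τ x)
  e := 1
  hT x y := map_add _ x y
  hQ x y := by
    rw [← map_add, ← map_add, ← map_add, map_add τ]
    congr 1; ring
  hB x y z := by
    simp only [add_mul, mul_add, map_add]; ring
  hs x y := add_comm _ _
  Te := by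
    have := Algebra.trace_algebraMap (S := F) (1 : ZMod 2)
    rw [map_one] at this
    rw [this, nsmul_eq_mul, mul_one]
    exact (ZMod.natCast_eq_one_iff_odd).mpr hodd
  Qe := by
    rw [map_one, mul_one]
    have := Algebra.trace_algebraMap (S := F) (1 : ZMod 2)
    rw [map_one] at this
    rw [this, nsmul_eq_mul, mul_one]
    exact (ZMod.natCast_eq_one_iff_odd).mpr hodd
  Be x := by
    rw [map_one, one_mul, mul_one, tr_inv']
    exact zmod2_add_self _
  rad x h0 h1 := by
    have hL : LL τ x ≠ 0 := fun h => by
      rcases fixed_of_LL τ hτ hodd x h with h | h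
      · exact h0 h
      · exact h1 h
    have : FiniteDimensional (ZMod 2) F := Module.Finite.of_finite
    obtain ⟨y, hy⟩ : ∃ y, Tr (LL τ x * y) ≠ 0 := by
      by_contra! hcon
      exact hL ((traceForm_nondegenerate (ZMod 2) F).1 _ hcon)
    exact ⟨y, by rw [← tr_LL]; exact (zmod2_ne_zero _).mp hy⟩

end field

lemma arith_pows (m : ℕ) (hm : 5 ≤ m) (hodd : Odd m) :
    ∃ k : ℕ, 1 ≤ k ∧ 2 ^ ((m - 3) / 2) = 2 * k ∧ 2 ^ (m - 3) = 4 * k ^ 2 ∧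
      2 ^ (m - 2) = 8 * k ^ 2 ∧ 2 ^ (m - 1) = 16 * k ^ 2 ∧ 2 ^ m = 32 * k ^ 2 ∧
      2 ^ ((m + 1) / 2) = 8 * k := by
  obtain ⟨j, rfl⟩ := hodd
  obtain ⟨i, rfl⟩ : ∃ i, j = i + 2 := ⟨j - 2, by omega⟩
  refine ⟨2 ^ i, Nat.one_le_two_pow, ?_, ?_, ?_, ?_, ?_, ?_⟩
  · rw [show (2 * (i + 2) + 1 - 3) / 2 = i + 1 by omega]; ring
  · rw [show 2 * (i + 2) + 1 - 3 = 2 * i + 2 by omega]; ring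
  · rw [show 2 * (i + 2) + 1 - 2 = 2 * i + 3 by omega]; ring
  · rw [show 2 * (i + 2) + 1 - 1 = 2 * i + 4 by omega]; ring
  · ring
  · rw [show (2 * (i + 2) + 1 + 1) / 2 = i + 3 by omega]; ring

set_option maxHeartbeats 4000000

theorem designs_from_codeD_minus (m u : ℕ) (hm : 5 ≤ m) (hmodd : Odd m) (hu : 0 < u)
    (hgcd : Nat.gcd u m = 1) (ρ : ZMod 2)
    (hρ : (Even ((m ^ 2 - 1) / 8) ∧ ρ = 0) ∨ (Odd ((m ^ 2 - 1) / 8) ∧ ρ = 1)) (n : ℕ) (hn : n = 2 ^ (m - 2) - 2 ^ ((m - 3) / 2)) :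
    HoldsTwoDesign (codeD m u ρ : Set (↥(Dset m u ρ) → ZMod 2)) (2 ^ (m - 3) - 2 ^ ((m - 3) / 2))
      (2 ^ (m - 3) - 2 ^ ((m - 3) / 2) - 1) ∧
    ∃ lam : ℕ, HoldsTwoDesign (codeD m u ρ : Set (↥(Dset m u ρ) → ZMod 2)) (2 ^ (m - 3)) lam ∧
      lam * (n * (n - 1)) = (2 ^ (m - 1) - 1) * 2 ^ (m - 3) * (2 ^ (m - 3) - 1) := by
  classical
  have hm0 : m ≠ 0 := by omega
  have hfin : Module.finrank (ZMod 2) (GaloisField 2 m) = m := GaloisField.finrank 2 hm0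
  have hFD : FiniteDimensional (ZMod 2) (GaloisField 2 m) := Module.Finite.of_finite
  let _ : Fintype (GaloisField 2 m) := Fintype.ofFinite _
  have hcardF : Fintype.card (GaloisField 2 m) = 2 ^ m := by
    rw [← Nat.card_eq_fintype_card, GaloisField.card 2 m hm0]
  set σ := FiniteField.frobeniusAlgEquivOfAlgebraic (ZMod 2) (GaloisField 2 m) with hσ
  set τ := σ ^ u with hτdef
  have hordσ : orderOf σ = m := by
    rw [hσ, FiniteField.orderOf_frobeniusAlgEquivOfAlgebraic, hfin]
  have hordτ : orderOf τ = m := by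
    rw [hτdef, orderOf_pow' _ hu.ne', hordσ, Nat.gcd_comm, hgcd, Nat.div_one]
  have hτ : ∀ g, g ∈ Subgroup.zpowers τ := by
    have hc : Nat.card (Subgroup.zpowers τ) = Nat.card Gal(GaloisField 2 m/ZMod 2) := by
      rw [Nat.card_zpowers, hordτ, IsGalois.card_aut_eq_finrank, hfin]
    have := Subgroup.eq_top_of_card_eq _ hc
    intro g; rw [this]; trivial
  have hτx : ∀ x, x * τ x = x ^ (2 ^ u + 1) := by
    intro x
    rw [hτdef, AlgEquiv.coe_pow, hσ, FiniteField.coe_frobeniusAlgEquivOfAlgebraic_iterate]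
    simp [pow_succ, mul_comm]
  have hodd' : Odd (Module.finrank (ZMod 2) (GaloisField 2 m)) := by rw [hfin]; exact hmodd
  obtain ⟨D, hD⟩ : ∃ D, D = fieldData τ hτ hodd' := ⟨_, rfl⟩
  have hDT : ∀ x, D.T x = Algebra.trace (ZMod 2) _ x := fun x => by rw [hD]; rfl
  have hDQ : ∀ x, D.Q x = Algebra.trace (ZMod 2) _ (x * τ x) := fun x => by rw [hD]; rfl
  have hDB : ∀ x y, D.B x y = Algebra.trace (ZMod 2) _ (LL τ x * y) := fun x y => by
    rw [tr_LL, hD]; rfl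
  have hDe : D.e = 1 := by rw [hD]; rfl
  have hS : D.S = chi ρ * 2 ^ ((m + 1) / 2) := by
    rw [← trMM m hmodd ρ hρ, QData.S]
    simp only [hDT, hDQ]
    obtain ⟨j, rfl⟩ : ∃ j, m = j + 1 := ⟨m - 1, by omega⟩
    exact S_eval j hfin hmodd τ hτ
  obtain ⟨k, hk1, a1, a2, a3, a4, a5, a6⟩ := arith_pows m hm hmodd
  have hS' : chi ρ * D.S = 8 * k := by
    rw [hS, ← mul_assoc, QData.chi_sq, one_mul]; exact_mod_cast a6
  have hcardZ : (Fintype.card (GaloisField 2 m) : ℤ) = 32 * k ^ 2 := by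
    rw [hcardF, a5]; push_cast; ring
  have hmem : ∀ d, d ∈ Dset m u ρ ↔ D.T d = 1 ∧ D.Q d = ρ := by
    intro d; rw [hDT, hDQ, hτx]; rfl
  -- the words
  let Φ : GaloisField 2 m → GaloisField 2 m := fun x => LL τ x + D.T x • 1
  let W : GaloisField 2 m → (↥(Dset m u ρ) → ZMod 2) := fun x => codeMap m u ρ (Φ x)
  have hW : ∀ x d, W x d = D.T x + D.B x d := by
    intro x d
    have hd := ((hmem d).mp d.2).1
    rw [hDT] at hd
    change Algebra.trace (ZMod 2) _ ((LL τ x + D.T x • 1) * (d : GaloisField 2 m)) = _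
    rw [add_mul, map_add, smul_mul_assoc, map_smul, one_mul, hd, hDB, smul_eq_mul, mul_one,
      add_comm]
  have hwt : ∀ x, wt (W x) = (univ.filter fun d => D.T d = 1 ∧ D.Q d = ρ ∧
      D.B x d = 1 + D.T x).card := by
    intro x
    rw [wt, ← Fintype.card_subtype, ← Nat.card_eq_fintype_card]
    have hiff : ∀ a b : ZMod 2, a + b ≠ 0 ↔ b = 1 + a := by decide
    refine Nat.card_congr
      { toFun := fun d => ⟨d.1.1, ((hmem _).mp d.1.2).1, ((hmem _).mp d.1.2).2, ?_⟩
        invFun := fun d => ⟨⟨d.1, (hmem _).mpr ⟨d.2.1, d.2.2.1⟩⟩, ?_⟩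
        left_inv := fun d => rfl
        right_inv := fun d => rfl }
    · have := d.2
      rw [hW, hiff] at this
      exact this
    · rw [hW, hiff]
      exact d.2.2.2
  have hwt0 : ∀ x, x ≠ 0 → x ≠ 1 → D.Q x = 0 → wt (W x) = 4 * k ^ 2 := by
    intro x h0 h1 hQ
    have := D.count_weight ρ (1 + D.T x) x h0 (by rw [hDe]; exact h1)
    rw [← hwt, hQ, zero_add, chi_add, chi_one, hcardZ] at this
    have h2 := QData.chi_sq (D.T x)
    have h8 : (8 : ℤ) * (wt (W x) : ℤ) = 8 * (4 * k ^ 2) := by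
      linear_combination this + chi ρ * D.S * h2
    have h9 : (wt (W x) : ℤ) = 4 * k ^ 2 := by linarith
    exact_mod_cast h9
  have hwt1 : ∀ x, x ≠ 0 → x ≠ 1 → D.Q x = 1 → (wt (W x) : ℤ) = 4 * k ^ 2 - 2 * k := by
    intro x h0 h1 hQ
    have := D.count_weight ρ (1 + D.T x) x h0 (by rw [hDe]; exact h1)
    rw [← hwt, hQ, chi_add, chi_one, hcardZ] at this
    have h2 := QData.chi_sq (D.T x)
    have : (8 : ℤ) * (wt (W x) : ℤ) = 8 * (4 * k ^ 2 - 2 * k) := by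
      linear_combination this - chi ρ * D.S * h2 - 2 * hS'
    linarith
  have hQe : D.Q 1 = 1 := by rw [← hDe]; exact D.Qe
  have hTe : D.T 1 = 1 := by rw [← hDe]; exact D.Te
  have hBe : ∀ x, D.B 1 x = 0 := by rw [← hDe]; exact D.Be
  have hT0 : D.T 0 = 0 := by rw [hDT, map_zero]
  have hQ0 : D.Q 0 = 0 := by rw [hDQ, zero_mul, map_zero]
  have hB0 : ∀ x, D.B 0 x = 0 := by
    intro x; have := D.hB 0 0 x; rw [add_zero] at this; simpa using this
  have hwte : (wt (W 1) : ℤ) = 8 * k ^ 2 - 2 * k := by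
    have h := D.count_n ρ
    rw [hwt, hTe]
    simp only [hBe, zmod2_add_self, and_true]
    rw [hcardZ, hS'] at h
    linarith
  have hwtz : wt (W 0) = 0 := by
    rw [hwt, hT0]
    simp [hB0]
  have hkk : (1 : ℤ) ≤ k := by exact_mod_cast hk1
  have hksq : (k : ℤ) ≤ k ^ 2 := by nlinarith
  have hwpos : ∀ x, x ≠ 0 → wt (W x) ≠ 0 := by
    intro x h0 hw
    by_cases h1 : x = 1
    · rw [h1] at hw; rw [hw] at hwte; push_cast at hwte; nlinarith
    · rcases zmod2_cases (D.Q x) with h | h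
      · have := hwt0 x h0 h1 h
        rw [hw] at this; have : 0 < 4 * k ^ 2 := by positivity
        omega
      · have := hwt1 x h0 h1 h
        rw [hw] at this; push_cast at this; nlinarith
  have hWadd : ∀ x y, W (x + y) = W x + W y := by
    intro x y; funext d
    rw [Pi.add_apply, hW, hW, hW, D.hT, D.hB]; ring
  have hWinj : Function.Injective W := by
    intro x y hxy
    by_contra hne
    apply hwpos (x + y)
    · intro h
      apply hne
      have := field_add_self y
      linear_combination h - this
    · rw [hWadd, hxy, wt]
      have : ∀ i, ¬ ((W y + W y) i ≠ 0) := by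
        intro i; rw [Pi.add_apply, zmod2_add_self]; simp
      simp [zmod2_add_self]
  have hΦinj : Function.Injective Φ := by
    intro x y h
    apply hWinj
    change codeMap m u ρ (Φ x) = codeMap m u ρ (Φ y)
    rw [h]
  have hΦsurj : Function.Surjective Φ := Finite.surjective_of_injective hΦinj
  have hrange : ∀ c, c ∈ (codeD m u ρ : Set (↥(Dset m u ρ) → ZMod 2)) ↔ ∃ x, W x = c := by
    intro c
    constructor
    · rintro ⟨b, rfl⟩
      obtain ⟨x, rfl⟩ := hΦsurj b
      exact ⟨x, rfl⟩
    · rintro ⟨x, rfl⟩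
      exact ⟨_, rfl⟩
  have hcount : ∀ (w : ℕ) (p q : ↥(Dset m u ρ)),
      Nat.card {c : ↥(Dset m u ρ) → ZMod 2 // c ∈ (codeD m u ρ : Set (↥(Dset m u ρ) → ZMod 2)) ∧
        wt c = w ∧ c p ≠ 0 ∧ c q ≠ 0} = (univ.filter fun x => wt (W x) = w ∧
          D.T x + D.B p x = 1 ∧ D.T x + D.B q x = 1).card := by
    intro w p q
    rw [← Fintype.card_subtype, ← Nat.card_eq_fintype_card]
    symm
    refine Nat.card_eq_of_bijective (fun x => ⟨W x.1, (hrange _).mpr ⟨_, rfl⟩, x.2.1, ?_, ?_⟩) ⟨?_, ?_⟩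
    · rw [hW, zmod2_ne_zero, D.hs]; exact x.2.2.1
    · rw [hW, zmod2_ne_zero, D.hs]; exact x.2.2.2
    · intro x y h
      exact Subtype.ext (hWinj (congrArg Subtype.val h))
    · rintro ⟨c, hc, hw, hp, hq⟩
      obtain ⟨x, rfl⟩ := (hrange c).mp hc
      rw [hW, zmod2_ne_zero, D.hs] at hp hq
      exact ⟨⟨x, hw, hp, hq⟩, rfl⟩
  have hpq : ∀ p q : ↥(Dset m u ρ), p ≠ q → (p : GaloisField 2 m) + q ≠ 0 := by
    intro p q hne h
    apply hne
    apply Subtype.ext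
    have := field_add_self (q : GaloisField 2 m)
    linear_combination h - this
  have hdes : ∀ (η : ZMod 2) (p q : ↥(Dset m u ρ)), p ≠ q →
      ((univ.filter fun x => D.Q x = η ∧ D.T x + D.B p x = 1 ∧ D.T x + D.B q x = 1).card : ℤ)
        = 4 * k ^ 2 + 2 * k * chi η := by
    intro η p q hne
    have := D.count_design ρ η p q ((hmem p).mp p.2).1 ((hmem p).mp p.2).2
      ((hmem q).mp q.2).1 ((hmem q).mp q.2).2 (hpq p q hne)
    rw [hcardZ] at this
    have h8 : (8 : ℤ) * ((univ.filter fun x => D.Q x = η ∧ D.T x + D.B p x = 1 ∧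
        D.T x + D.B q x = 1).card : ℤ) = 8 * (4 * k ^ 2 + 2 * k * chi η) := by
      linear_combination this + 2 * chi η * hS'
    linarith
  have hle : 2 * k ≤ 4 * k ^ 2 := by nlinarith
  have hwt1' : ∀ x, wt (W x) = 4 * k ^ 2 - 2 * k ↔ D.Q x = 1 ∧ x ≠ 1 := by
    intro x
    have hz : wt (W x) = 4 * k ^ 2 - 2 * k ↔ (wt (W x) : ℤ) = 4 * k ^ 2 - 2 * k := by
      zify [hle]
    rw [hz]
    constructor
    · intro h
      by_cases h0 : x = 0
      · rw [h0, hwtz] at h; push_cast at h; nlinarith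
      by_cases h1 : x = 1
      · rw [h1, hwte] at h; nlinarith
      refine ⟨?_, h1⟩
      rcases zmod2_cases (D.Q x) with hq | hq
      · rw [hwt0 x h0 h1 hq] at h; push_cast at h; nlinarith
      · exact hq
    · rintro ⟨h, h1⟩
      refine hwt1 x ?_ h1 h
      rintro rfl
      rw [hQ0] at h; exact zero_ne_one h
  have hwt0' : ∀ x, wt (W x) = 4 * k ^ 2 ↔ D.Q x = 0 ∧ x ≠ 0 := by
    intro x
    constructor
    · intro h
      by_cases h0 : x = 0
      · rw [h0, hwtz] at h; nlinarith
      by_cases h1 : x = 1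
      · have : (wt (W x) : ℤ) = 4 * k ^ 2 := by rw [h]; push_cast; ring
        rw [h1, hwte] at this; nlinarith
      refine ⟨?_, h0⟩
      rcases zmod2_cases (D.Q x) with hq | hq
      · exact hq
      · have := hwt1 x h0 h1 hq
        rw [h] at this; push_cast at this; nlinarith
    · rintro ⟨h, h0⟩
      refine hwt0 x h0 ?_ h
      rintro rfl
      rw [hQe] at h; exact one_ne_zero h
  rw [a1, a2]
  refine ⟨?_, 4 * k ^ 2 + 2 * k, ?_, ?_⟩
  · intro p q hne
    rw [hcount]
    have h1 : (univ.filter fun x => wt (W x) = 4 * k ^ 2 - 2 * k ∧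
          D.T x + D.B p x = 1 ∧ D.T x + D.B q x = 1) = (univ.filter fun x => D.Q x = 1 ∧
          D.T x + D.B p x = 1 ∧ D.T x + D.B q x = 1).erase 1 := by
      ext x
      simp only [mem_filter, mem_erase, mem_univ, true_and, hwt1']
      tauto
    rw [h1, Finset.card_erase_of_mem]
    · have := hdes 1 p q hne
      rw [chi_one] at this
      have h2 : (univ.filter fun x => D.Q x = 1 ∧
          D.T x + D.B p x = 1 ∧ D.T x + D.B q x = 1).card = 4 * k ^ 2 - 2 * k := by
        zify [hle]; linarith
      rw [h2]
    · simp only [mem_filter, mem_univ, true_and]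
      rw [D.hs, D.hs _ 1, hBe, hBe, hQe, hTe]; simp
  · intro p q hne
    rw [hcount]
    have h1 : (univ.filter fun x => wt (W x) = 4 * k ^ 2 ∧
          D.T x + D.B p x = 1 ∧ D.T x + D.B q x = 1) = (univ.filter fun x => D.Q x = 0 ∧
          D.T x + D.B p x = 1 ∧ D.T x + D.B q x = 1) := by
      ext x
      simp only [mem_filter, mem_univ, true_and, hwt0']
      constructor
      · tauto
      · rintro ⟨h, h', h''⟩
        refine ⟨⟨h, ?_⟩, h', h''⟩
        rintro rfl
        rw [hT0, D.hs, hB0] at h'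
        simp at h'
    rw [h1]
    have := hdes 0 p q hne
    rw [chi_zero] at this
    zify; linarith
  · rw [hn, a1, a3, a4]
    have h1 : 2 * k ≤ 8 * k ^ 2 := by nlinarith
    have h2 : 1 ≤ 8 * k ^ 2 - 2 * k := by
      have : 2 * k + 1 ≤ 8 * k ^ 2 := by nlinarith
      omega
    have h3 : 1 ≤ 16 * k ^ 2 := by nlinarith
    have h4 : 1 ≤ 4 * k ^ 2 := by nlinarith
    zify [h1, h2, h3, h4]
    ring
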